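/- Let C_r be the cycle on vertices {1,…,r} with edges {i,i+1} for 1 ≤ i ≤ r (indices modulo r), where r ≥ 3. Then I(C_r) equals the ideal generated by M_e(C_r), and M_e(C_r) is the minimal monomial generating set of I(C_r). -/

import Mathlib

open MvPolynomial

/-- Indicator: does the edge `e` cross the partition `A | Aᶜ`? -/
def crossBool {V : Type} [DecidableEq V] (A : Finset V) : Sym2 V → Bool :=
  Sym2.lift ⟨fun i j => xor (decide (i ∈ A)) (decide (j ∈ A)), fun i j => Bool.xor_comm _ _⟩

/-- The cut monomial `u_{A|B}` (with `B = Aᶜ`), formed from the edges in `E'`,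
viewed in the polynomial ring `S` on variables `s_e = X (e, true)`, `t_e = X (e, false)`
indexed by the edges of the ambient graph `G`. -/
noncomputable def cutGen (k : Type) [Field k] {V : Type} [DecidableEq V]
    (G : SimpleGraph V) (E' : Finset (Sym2 V)) (hE' : ↑E' ⊆ G.edgeSet) (A : Finset V) :
    MvPolynomial (↥G.edgeSet × Bool) k :=
  ∏ e ∈ E'.attach, X (⟨⟨e.1, hE' e.2⟩, crossBool A e.1⟩ : ↥G.edgeSet × Bool)

/-- The monomial cut ideal of the subgraph of `G` with edge set `E'`,
viewed as an ideal of the polynomial ring associated to `G`. -/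
noncomputable def cutIdealOn (k : Type) [Field k] {V : Type} [DecidableEq V]
    (G : SimpleGraph V) (E' : Finset (Sym2 V)) (hE' : ↑E' ⊆ G.edgeSet) :
    Ideal (MvPolynomial (↥G.edgeSet × Bool) k) :=
  Ideal.span (Set.range (cutGen k G E' hE'))

/-- The monomial cut ideal `I(G)` of the graph `G`. -/
noncomputable def cutIdeal (k : Type) [Field k] {V : Type} [DecidableEq V]
    (G : SimpleGraph V) [Fintype G.edgeSet] :
    Ideal (MvPolynomial (↥G.edgeSet × Bool) k) :=
  cutIdealOn k G G.edgeSet.toFinset (by simp)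

/-- `M_e(C_r)`: the set of squarefree monomials of total degree `r` with even `s`-degree
that are divisible by no product `s_e * t_e`. -/
noncomputable def Me (k : Type) [Field k] (r : ℕ)
    [Fintype (SimpleGraph.cycleGraph r).edgeSet] :
    Set (MvPolynomial (↥(SimpleGraph.cycleGraph r).edgeSet × Bool) k) :=
  {m | ∃ d : (↥(SimpleGraph.cycleGraph r).edgeSet × Bool) →₀ ℕ,
    m = monomial d 1 ∧ (∀ v, d v ≤ 1) ∧ (d.sum fun _ n => n) = r ∧
    Even (∑ e : ↥(SimpleGraph.cycleGraph r).edgeSet, d (e, true)) ∧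
    ∀ e : ↥(SimpleGraph.cycleGraph r).edgeSet, ¬ (d (e, true) ≠ 0 ∧ d (e, false) ≠ 0)}

theorem edge_equiv_aux (n : ℕ) : ∃ φ : Fin (n+3) ≃ ↥(SimpleGraph.cycleGraph (n+3)).edgeSet,
    ∀ i, ((φ i : _) : Sym2 (Fin (n+3))) = s(i, i+1) := by
  have hadj : ∀ i : Fin (n+3), s(i, i+1) ∈ (SimpleGraph.cycleGraph (n+3)).edgeSet := by
    intro i
    rw [SimpleGraph.mem_edgeSet, SimpleGraph.cycleGraph_adj]
    right; simp
  refine ⟨Equiv.ofBijective (fun i => ⟨s(i, i+1), hadj i⟩) ⟨?_, ?_⟩, fun i => rfl⟩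
  · intro i j h
    simp only [Subtype.mk.injEq, Sym2.eq_iff] at h
    rcases h with h | ⟨h1, h2⟩
    · exact h.1
    · exfalso
      rw [h1, add_assoc] at h2
      have h3 : (1 + 1 : Fin (n+3)) = 0 := by simpa using h2
      have h4 := congrArg Fin.val h3
      simp [Fin.val_add] at h4
      rw [Nat.mod_eq_of_lt (by omega)] at h4
      omega
  · rintro ⟨e, he⟩
    induction e using Sym2.ind with
    | _ x y =>
      have he' := he
      rw [SimpleGraph.mem_edgeSet, SimpleGraph.cycleGraph_adj] at he'
      rcases he' with h | h
      · refine ⟨y, Subtype.ext ?_⟩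
        have : x = y + 1 := by rw [← h]; abel
        simp [this, Sym2.eq_swap]
      · refine ⟨x, Subtype.ext ?_⟩
        have : y = x + 1 := by rw [← h]; abel
        simp [this]

/-- exponent vector of a sign choice -/
noncomputable def expVec {E : Type} [Fintype E] (f : E → Bool) : (E × Bool) →₀ ℕ :=
  ∑ e : E, Finsupp.single (e, f e) 1

theorem expVec_apply {E : Type} [Fintype E] (f : E → Bool) (e : E) (b : Bool) :
    expVec f (e, b) = if f e = b then 1 else 0 := by
  classical
  unfold expVec
  rw [Finsupp.finsetSum_apply, Finset.sum_eq_single e]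
  · simp [Finsupp.single_apply]
  · intro e' _ h
    simp [Finsupp.single_apply, h]
  · simp

theorem cutGen_eq (k : Type) [Field k] {V : Type} [DecidableEq V]
    (G : SimpleGraph V) [Fintype G.edgeSet] (h : ↑G.edgeSet.toFinset ⊆ G.edgeSet) (A : Finset V) :
    cutGen k G G.edgeSet.toFinset h A
      = monomial (expVec fun e : G.edgeSet => crossBool A e.1) 1 := by
  unfold cutGen expVec
  rw [monomial_sum_one]
  refine Finset.prod_bij (fun e _ => ⟨e.1, h e.2⟩) ?_ ?_ ?_ ?_
  · simp
  · rintro ⟨a, _⟩ _ ⟨b, _⟩ _ hab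
    simpa using hab
  · rintro ⟨e, he⟩ _
    exact ⟨⟨e, by simpa using he⟩, by simp, rfl⟩
  · intros; rfl

theorem degree_sum {E : Type} [Fintype E] (d : (E × Bool) →₀ ℕ) :
    (d.sum fun _ n => n) = ∑ e : E, (d (e, true) + d (e, false)) := by
  rw [Finsupp.sum_fintype _ _ (by simp), Fintype.sum_prod_type]
  simp

theorem even_cross (n : ℕ) (A : Finset (Fin (n+3))) :
    Even (∑ i : Fin (n+3), if crossBool A s(i, i+1) = true then 1 else 0) := by
  have h1 : ∑ i : Fin (n+3), (if i + 1 ∈ A then (1 : ZMod 2) else 0)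
      = ∑ i : Fin (n+3), (if i ∈ A then (1 : ZMod 2) else 0) :=
    Equiv.sum_comp (Equiv.addRight (1 : Fin (n+3))) (fun i => if i ∈ A then (1 : ZMod 2) else 0)
  rw [← ZMod.natCast_eq_zero_iff_even]
  push_cast
  have h2 : ∀ i : Fin (n+3), (if crossBool A s(i, i+1) = true then (1 : ZMod 2) else 0)
      = (if i ∈ A then 1 else 0) + (if i + 1 ∈ A then 1 else 0) := by
    intro i
    simp only [crossBool, Sym2.lift_mk]
    by_cases ha : i ∈ A <;> by_cases hb : i + 1 ∈ A <;> simp [ha, hb]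
    decide
  simp only [h2, Finset.sum_add_distrib, h1]
  exact CharTwo.add_self_eq_zero _

theorem exists_cut (n : ℕ) (f : Fin (n+3) → Bool)
    (hf : Even (∑ i, if f i = true then 1 else 0)) :
    ∃ A : Finset (Fin (n+3)), ∀ i, crossBool A s(i, i+1) = f i := by
  let g : ℕ → ℕ := fun j => if h : j < n+3 then (if f ⟨j, h⟩ = true then 1 else 0) else 0
  let P : ℕ → ℕ := fun j => ∑ x ∈ Finset.range j, g x
  have hP : ∀ j, P (j+1) = P j + g j := fun j => Finset.sum_range_succ _ _
  have hg : ∀ i : Fin (n+3), g i = if f i = true then 1 else 0 := fun i => by simp [g]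
  have htot : Even (P (n+3)) := by
    have : P (n+3) = ∑ i, if f i = true then 1 else 0 := by
      simp only [P, Finset.sum_range]
      exact Finset.sum_congr rfl fun i _ => hg i
    rwa [this]
  refine ⟨Finset.univ.filter fun i => Odd (P i), fun i => ?_⟩
  have key : Odd (P ((i + 1 : Fin (n+3)) : ℕ)) ↔ Odd (P ((i : ℕ) + 1)) := by
    by_cases h : i = Fin.last (n+2)
    · subst h
      have : P 0 = 0 := by simp [P]
      simp only [Fin.last_add_one, Fin.val_zero, this, Fin.val_last]
      rw [← Nat.not_even_iff_odd, ← Nat.not_even_iff_odd]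
      simp [htot]
    · rw [Fin.val_add_one_of_lt (Fin.lt_last_iff_ne_last.mpr h)]
  simp only [crossBool, Sym2.lift_mk, Finset.mem_filter, Finset.mem_univ, true_and, key, hP, hg]
  cases hfi : f i <;> by_cases ho : Odd (P i) <;> simp [ho, Nat.odd_add_one]

theorem range_eq_Me (k : Type) [Field k] (n : ℕ)
    [Fintype (SimpleGraph.cycleGraph (n+3)).edgeSet]
    (h : ↑(SimpleGraph.cycleGraph (n+3)).edgeSet.toFinset ⊆
      (SimpleGraph.cycleGraph (n+3)).edgeSet) :
    Set.range (cutGen k (SimpleGraph.cycleGraph (n+3))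
      (SimpleGraph.cycleGraph (n+3)).edgeSet.toFinset h) = Me k (n+3) := by
  obtain ⟨φ, hφ⟩ := edge_equiv_aux n
  have hcard : Fintype.card ↥(SimpleGraph.cycleGraph (n+3)).edgeSet = n+3 := by
    rw [← Fintype.card_congr φ, Fintype.card_fin]
  ext m
  constructor
  · rintro ⟨A, rfl⟩
    refine ⟨_, cutGen_eq k _ h A, ?_, ?_, ?_, ?_⟩
    · rintro ⟨e, b⟩
      rw [expVec_apply]; split_ifs <;> simp
    · rw [degree_sum]
      simp only [expVec_apply]
      rw [Finset.sum_congr rfl (g := fun _ => 1)]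
      · simpa using hcard
      · intro e _
        cases crossBool A e.1 <;> simp
    · rw [← Equiv.sum_comp φ]
      simp only [expVec_apply, hφ]
      exact even_cross n A
    · intro e
      simp only [expVec_apply]
      cases crossBool A e.1 <;> simp
  · rintro ⟨d, rfl, h1, h2, h3, h4⟩
    rw [degree_sum] at h2
    have hle : ∀ e, d (e, true) + d (e, false) ≤ 1 := by
      intro e
      have := h1 (e, true); have := h1 (e, false); have := h4 e
      omega
    have heq : ∀ e, d (e, true) + d (e, false) = 1 := by
      have := (Finset.sum_eq_sum_iff_of_le (s := Finset.univ) (fun e _ => hle e)).1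
        (by rw [h2]; simpa using hcard.symm)
      exact fun e => this e (Finset.mem_univ e)
    have hd : ∀ e, d (e, true) = if decide (d (e, true) = 1) = true then 1 else 0 := by
      intro e
      have := hle e
      simp only [decide_eq_true_eq]
      split_ifs <;> omega
    obtain ⟨A, hA⟩ := exists_cut n (fun i => decide (d (φ i, true) = 1)) (by
      rw [← Equiv.sum_comp φ] at h3
      simpa only [← hd] using h3)
    refine ⟨A, ?_⟩
    rw [cutGen_eq]
    refine congrArg (fun x => monomial x (1 : k)) (Finsupp.ext ?_)
    rintro ⟨e, b⟩
    rw [expVec_apply]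
    obtain ⟨i, rfl⟩ := φ.surjective e
    rw [hφ, hA]
    have := heq (φ i)
    cases b
    · by_cases hx : d (φ i, true) = 1 <;> simp [hx] <;> omega
    · by_cases hx : d (φ i, true) = 1 <;> simp [hx] <;> omega

/-- For the cycle `C_r` (`r ≥ 3`), `I(C_r)` is generated by `M_e(C_r)`, and `M_e(C_r)` is
its minimal monomial generating set (no element of `M_e(C_r)` divides another). -/
theorem monomial_cut_ideal_cycle_generators
    (k : Type) [Field k] (r : ℕ) (hr : 3 ≤ r)
    [DecidableRel (SimpleGraph.cycleGraph r).Adj]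
    [Fintype (SimpleGraph.cycleGraph r).edgeSet] :
    cutIdeal k (SimpleGraph.cycleGraph r) = Ideal.span (Me k r) ∧
    (∀ m ∈ Me k r, ∀ m' ∈ Me k r, m ≠ m' → ¬ m ∣ m') := by
  obtain ⟨n, rfl⟩ : ∃ n, r = n + 3 := ⟨r - 3, by omega⟩
  refine ⟨?_, ?_⟩
  · unfold cutIdeal cutIdealOn
    rw [range_eq_Me]
  · rintro _ ⟨d, rfl, -, h2, -, -⟩ _ ⟨d', rfl, -, h2', -, -⟩ hne hdvd
    apply hne
    rw [monomial_dvd_monomial] at hdvd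
    have hle : d ≤ d' := by
      rcases hdvd.1 with h | h
      · exact absurd h one_ne_zero
      · exact h
    rw [Finsupp.sum_fintype _ _ (by simp)] at h2 h2'
    have := (Finset.sum_eq_sum_iff_of_le (s := Finset.univ) (fun e _ => hle e)).1
      (h2.trans h2'.symm)
    have hdd : d = d' := Finsupp.ext fun v => this v (Finset.mem_univ v)
    rw [hdd]
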